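/- arXiv:2510.11272 — 3 statements merged into one kernel-verified Lean document; each statement's English description precedes it below -/
import Mathlib

section
/- Let R be a Bezout domain with field of fractions K. For every matrix M ∈ SL₂(K) that is not upper triangular (i.e. M ∉ B₂⁺(K)), there exists a matrix g ∈ SL₂(R) that is not upper triangular (g ∉ B₂⁺(R)) such that g⁻¹·M ∈ B₂⁺(K), where g is identified with its image in SL₂(K). -/
/-- Over a Bezout domain, any fraction `x / y` equals a fraction `p / q` with `p`, `q` coprime. -/
lemma IsBezout.exists_isCoprime_mul_eq_mul {R : Type*} [CommRing R] [IsDomain R] [IsBezout R]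
    (x : R) {y : R} (hy : y ≠ 0) :
    ∃ p q : R, q ≠ 0 ∧ IsCoprime p q ∧ q * x = p * y := by
  obtain ⟨p, hp⟩ := IsBezout.gcd_dvd_left x y
  obtain ⟨q, hq⟩ := IsBezout.gcd_dvd_right x y
  obtain ⟨a, b, hab⟩ := IsBezout.gcd_eq_sum x y
  generalize IsBezout.gcd x y = d at hp hq hab
  subst hp hq
  refine ⟨p, q, right_ne_zero_of_mul hy, ⟨a, b, ?_⟩, by ring⟩
  exact mul_left_cancel₀ (left_ne_zero_of_mul hy) (by linear_combination hab)


/-- Let `R` be a Bezout domain with field of fractions `K`. For every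
`M ∈ SL₂(K)` that is not upper triangular, there exists `g ∈ SL₂(R)` not upper triangular such
that `g⁻¹ · M` is upper triangular (identifying `g` with its image in `SL₂(K)`). -/
theorem exists_nonUpperTriangular_sl2R_rep
    (R : Type*) [CommRing R] [IsDomain R] [IsBezout R]
    (K : Type*) [Field K] [Algebra R K] [IsFractionRing R K]
    (M : Matrix.SpecialLinearGroup (Fin 2) K)
    (hM : (M : Matrix (Fin 2) (Fin 2) K) 1 0 ≠ 0) :
    ∃ g : Matrix.SpecialLinearGroup (Fin 2) R,
      (g : Matrix (Fin 2) (Fin 2) R) 1 0 ≠ 0 ∧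
      ((((Matrix.SpecialLinearGroup.map (algebraMap R K) g)⁻¹ * M :
          Matrix.SpecialLinearGroup (Fin 2) K) : Matrix (Fin 2) (Fin 2) K) 1 0 = 0) := by
  obtain ⟨x, y, hy, hxy⟩ := IsFractionRing.div_surjective (A := R) (M 0 0 / M 1 0)
  have hy0 : y ≠ 0 := nonZeroDivisors.ne_zero hy
  have hyK : algebraMap R K y ≠ 0 := IsFractionRing.to_map_ne_zero_of_mem_nonZeroDivisors hy
  obtain ⟨p, q, hq, ⟨a, b, hab⟩, h⟩ := IsBezout.exists_isCoprime_mul_eq_mul x hy0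
  refine ⟨⟨!![p, -b; q, a], by rw [Matrix.det_fin_two_of]; linear_combination hab⟩,
    by simpa using hq, ?_⟩
  have hK : algebraMap R K q * algebraMap R K x = algebraMap R K p * algebraMap R K y := by
    simp only [← map_mul, h]
  rw [div_eq_div_iff hyK hM] at hxy
  have key : algebraMap R K p * M 1 0 = algebraMap R K q * M 0 0 :=
    mul_left_cancel₀ hyK (by linear_combination algebraMap R K q * hxy - M 1 0 * hK)
  rw [Matrix.SpecialLinearGroup.coe_mul, Matrix.SpecialLinearGroup.coe_inv,
    Matrix.adjugate_fin_two, Matrix.mul_apply, Fin.sum_univ_two]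
  change -algebraMap R K q * M 0 0 + algebraMap R K p * M 1 0 = 0
  linear_combination key
end

section
/- Let 𝒞 be a simply connected twin chamber system over a set I, let c ∈ 𝒞₊, and let G = (c₀, c₁, …, c_k) be a closed gallery in Opp(𝒞) such that the 𝒞₊-component of c_μ equals c for all μ = 0, …, k. Then G is null-homotopic in Opp(𝒞). -/
/-! ## Chamber systems, galleries, homotopy, and twin chamber systems -/

namespace TwinChamber

universe u v

variable {I : Type u} {C : Type v}

/-- Two chambers are `i`-adjacent for some `i ∈ J`. -/
def JAdj (adj : I → C → C → Prop) (J : Set I) (c d : C) : Prop := ∃ j ∈ J, adj j c d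

/-- Two chambers are adjacent if they are `i`-adjacent for some `i ∈ I`. -/
def Adj (adj : I → C → C → Prop) (c d : C) : Prop := ∃ i, adj i c d

/-- A gallery is a nonempty finite sequence of chambers in which consecutive chambers are
adjacent. -/
def IsGallery (adj : I → C → C → Prop) (l : List C) : Prop :=
  l ≠ [] ∧ l.Chain' (Adj adj)

/-- `d` lies in the `J`-residue of `c`: there is a `J`-gallery from `c` to `d`. -/
def InResidue (adj : I → C → C → Prop) (J : Set I) (c d : C) : Prop :=
  Relation.ReflTransGen (JAdj adj J) c d

/-- Two galleries are elementary homotopic if they coincide on an initial segment and a final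
segment, and the two intermediate subgalleries are `J`-galleries, with the same first and last
chambers, for some `J ⊆ I` with `|J| ≤ 2`. -/
def ElemHomotopic (adj : I → C → C → Prop) (G H : List C) : Prop :=
  ∃ (P M M' S : List C) (J : Set I),
    J.Finite ∧ J.ncard ≤ 2 ∧
    M ≠ [] ∧ M' ≠ [] ∧
    M.head? = M'.head? ∧ M.getLast? = M'.getLast? ∧
    M.Chain' (JAdj adj J) ∧ M'.Chain' (JAdj adj J) ∧
    G = P ++ M ++ S ∧ H = P ++ M' ++ S

/-- Two galleries are homotopic if they are connected by a finite chain of elementary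
homotopies. -/
def Homotopic (adj : I → C → C → Prop) : List C → List C → Prop :=
  Relation.ReflTransGen (ElemHomotopic adj)

/-- A closed gallery is null-homotopic if it is homotopic to the length-zero gallery at its
initial chamber. -/
def NullHomotopic (adj : I → C → C → Prop) (G : List C) : Prop :=
  ∃ c, G.head? = some c ∧ Homotopic adj G [c]

/-- A chamber system is connected if any two chambers are joined by a gallery. -/
def Connected (adj : I → C → C → Prop) : Prop :=
  ∀ c d : C, Relation.ReflTransGen (Adj adj) c d

/-- A chamber system is simply connected if it is connected and every closed gallery is
null-homotopic. -/
def SimplyConnected (adj : I → C → C → Prop) : Prop :=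
  Connected adj ∧
    ∀ G : List C, IsGallery adj G → G.head? = G.getLast? → NullHomotopic adj G

/-- The reduced gallery of a gallery: delete every chamber equal to its immediate
predecessor. -/
noncomputable def reduced (l : List C) : List C :=
  letI : DecidableEq C := Classical.decEq C
  l.destutter (· ≠ ·)

/-- A twin chamber system over `I`: a pair of chamber systems `(Cp, adjp)`, `(Cm, adjm)` over
`I` (each `adj i` an equivalence relation) together with a symmetric opposition relation `op`
between them, satisfying the axioms (TCS1)–(TCS4) for both signs. -/
structure TwinCS (I : Type u) : Type (max u (v + 1)) where
  /-- The positive chamber set. -/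
  Cp : Type v
  /-- The negative chamber set. -/
  Cm : Type v
  /-- `i`-adjacency on `Cp`. -/
  adjp : I → Cp → Cp → Prop
  /-- `i`-adjacency on `Cm`. -/
  adjm : I → Cm → Cm → Prop
  eqvp : ∀ i, Equivalence (adjp i)
  eqvm : ∀ i, Equivalence (adjm i)
  /-- The opposition relation between `Cp` and `Cm`. -/
  op : Cp → Cm → Prop
  tcs1p : ∀ (i j : I) (c d : Cp) (x y : Cm), adjp i c d → adjm j x y →
    op d x → op c x → op c y → op d y ∨ j = i
  tcs1m : ∀ (i j : I) (c d : Cm) (x y : Cp), adjm i c d → adjp j x y →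
    op x d → op x c → op y c → op y d ∨ j = i
  tcs2p : ∀ (i : I) (c d : Cp) (x : Cm), adjp i c d → op c x →
    ∃ y : Cm, adjm i x y ∧ op c y ∧ op d y
  tcs2m : ∀ (i : I) (c d : Cm) (x : Cp), adjm i c d → op x c →
    ∃ y : Cp, adjp i x y ∧ op y c ∧ op y d
  tcs3p : ∀ (c : Cp) (x y : Cm), op c x → op c y →
    Relation.ReflTransGen (fun u v => op c u ∧ op c v ∧ Adj adjm u v) x y
  tcs3pJ : ∀ (c : Cp) (J : Set I), J.Finite → J.ncard ≤ 2 → ∀ x y : Cm, op c x → op c y →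
    InResidue adjm J x y →
    Relation.ReflTransGen (fun u v => op c u ∧ op c v ∧ JAdj adjm J u v) x y
  tcs3m : ∀ (c : Cm) (x y : Cp), op x c → op y c →
    Relation.ReflTransGen (fun u v => op u c ∧ op v c ∧ Adj adjp u v) x y
  tcs3mJ : ∀ (c : Cm) (J : Set I), J.Finite → J.ncard ≤ 2 → ∀ x y : Cp, op x c → op y c →
    InResidue adjp J x y →
    Relation.ReflTransGen (fun u v => op u c ∧ op v c ∧ JAdj adjp J u v) x y
  tcs4p : ∀ c : Cp, ∃ ω : Cm → Cp,
    (∀ (i : I) (x y : Cm), adjm i x y → adjp i (ω x) (ω y)) ∧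
    (∀ x, op (ω x) x) ∧ (∀ x, op c x → ω x = c)
  tcs4m : ∀ c : Cm, ∃ ω : Cp → Cm,
    (∀ (i : I) (x y : Cp), adjp i x y → adjm i (ω x) (ω y)) ∧
    (∀ x, op x (ω x)) ∧ (∀ x, op x c → ω x = c)

/-- The chambers of `Opp(𝒞)`: pairs of opposite chambers. -/
def OppC (T : TwinCS.{u, v} I) : Type v := {p : T.Cp × T.Cm // T.op p.1 p.2}

/-- `i`-adjacency on `Opp(𝒞)`: componentwise `i`-adjacency. -/
def oppAdj (T : TwinCS.{u, v} I) : I → OppC T → OppC T → Prop :=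
  fun i u v => T.adjp i u.1.1 v.1.1 ∧ T.adjm i u.1.2 v.1.2

/-- A twin chamber system is simply connected if both of its halves are simply connected
chamber systems. -/
def TwinSC (T : TwinCS.{u, v} I) : Prop :=
  SimplyConnected T.adjp ∧ SimplyConnected T.adjm


theorem ElemHomotopic.map {D : Type*} {adj : I → C → C → Prop} {adj' : I → D → D → Prop}
    {f : C → D} (hf : ∀ i x y, adj i x y → adj' i (f x) (f y)) {G H : List C}
    (h : ElemHomotopic adj G H) : ElemHomotopic adj' (G.map f) (H.map f) := by
  obtain ⟨P, M, M', S, J, hJ, hJ2, hM, hM', hhead, hlast, hc, hc', rfl, rfl⟩ := h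
  have key : ∀ L : List C, L.IsChain (JAdj adj J) → (L.map f).IsChain (JAdj adj' J) :=
    fun L hL => (List.isChain_map f).2 (hL.imp fun x y ⟨j, hj, hxy⟩ => ⟨j, hj, hf j x y hxy⟩)
  exact ⟨P.map f, M.map f, M'.map f, S.map f, J, hJ, hJ2, by simpa using hM, by simpa using hM',
    by simp [hhead], by simp [hlast], key M hc, key M' hc', by simp, by simp⟩

theorem NullHomotopic.map {D : Type*} {adj : I → C → C → Prop} {adj' : I → D → D → Prop}
    {f : C → D} (hf : ∀ i x y, adj i x y → adj' i (f x) (f y)) {G : List C}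
    (h : NullHomotopic adj G) : NullHomotopic adj' (G.map f) := by
  obtain ⟨c, hc, hG⟩ := h
  exact ⟨f c, by simp [hc], hG.lift (List.map f) fun _ _ h => h.map hf⟩

/-- Let `𝒞` be a simply connected twin chamber system, `c ∈ 𝒞₊`, and `G` a
closed gallery in `Opp(𝒞)` all of whose chambers have `𝒞₊`-component equal to `c`. Then `G` is
null-homotopic in `Opp(𝒞)`. -/
theorem nullHomotopic_of_constant_plus_component {I : Type u} (T : TwinCS.{u, v} I)
    (hT : TwinSC T) (c : T.Cp) (G : List (OppC T))
    (hG : IsGallery (oppAdj T) G)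
    (hclosed : G.head? = G.getLast?)
    (hconst : ∀ u ∈ G, u.1.1 = c) :
    NullHomotopic (oppAdj T) G := by
  obtain ⟨ω, hadj, hop, hω⟩ := T.tcs4p c
  let f : T.Cm → OppC T := fun x => ⟨(ω x, x), hop x⟩
  have hfG : (G.map fun u => u.1.2).map f = G := by
    rw [List.map_map]
    have hfix : ∀ u ∈ G, (f ∘ fun u : OppC T => u.1.2) u = id u := fun u hu =>
      Subtype.ext (Prod.ext ((hω _ (hconst u hu ▸ u.2)).trans (hconst u hu).symm) rfl)
    exact (List.map_congr_left hfix).trans (List.map_id G)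
  have hnull : NullHomotopic T.adjm (G.map fun u => u.1.2) :=
    hT.2.2 _ ⟨by simpa using hG.1, (List.isChain_map _).2 (hG.2.imp fun _ _ ⟨i, h⟩ => ⟨i, h.2⟩)⟩
      (by simp [hclosed])
  exact hfG ▸ hnull.map (f := f) fun i x y h => ⟨hadj i x y h, h⟩

end TwinChamber
end

section
/- Let 𝒞 be a simply connected twin chamber system over a set I, let i ∈ I, let c, d ∈ 𝒞₊ with c ∼ᵢ d, and let (x₀, x₁, x₂) be a gallery contained in c^op such that x₀ op d and x₂ op d. Then there exists a gallery (x₂ = y₀, y₁, …, y_k = x₀) contained in d^op such that the closed gallery ((c,x₀), (c,x₁), (c,x₂), (d,y₀), (d,y₁), …, (d,y_k), (c,x₀)) is null-homotopic in Opp(𝒞). -/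
/-! ## Chamber systems, galleries, homotopy, and twin chamber systems -/

namespace TwinChamber

universe u v

variable {I : Type u} {C : Type v}

theorem ncard_pair_le_two (j k : I) : ({j, k} : Set I).ncard ≤ 2 :=
  (Set.ncard_insert_le j {k}).trans (by rw [Set.ncard_singleton])

/-- A closed gallery using at most two types is null-homotopic. -/
theorem nullHomotopic_of_isChain_pair {adj : I → C → C → Prop} {a : C} {G : List C} (j k : I)
    (hne : G ≠ []) (hhead : G.head? = some a) (hlast : G.getLast? = some a)
    (hG : G.IsChain (JAdj adj {j, k})) : NullHomotopic adj G :=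
  ⟨a, hhead, .single ⟨[], G, [a], [], {j, k}, Set.toFinite _, ncard_pair_le_two j k, hne,
    by simp, hhead, hlast, hG, .singleton a, by simp, rfl⟩⟩

/-- Let `𝒞` be a simply connected twin chamber system, `i ∈ I`, `c ∼ᵢ d` in
`𝒞₊`, and `(x₀, x₁, x₂)` a gallery in `c^op` with `x₀ op d` and `x₂ op d`. Then there is a
gallery `(x₂ = y₀, …, y_k = x₀)` in `d^op` such that the closed gallery
`((c,x₀), (c,x₁), (c,x₂), (d,y₀), …, (d,y_k), (c,x₀))` is null-homotopic in `Opp(𝒞)`. -/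
theorem nullHomotopic_triangle {I : Type u} (T : TwinCS.{u, v} I) (hT : TwinSC T)
    (i : I) (c d : T.Cp) (hcd : T.adjp i c d)
    (x₀ x₁ x₂ : T.Cm)
    (h01 : Adj T.adjm x₀ x₁) (h12 : Adj T.adjm x₁ x₂)
    (hc0 : T.op c x₀) (hc1 : T.op c x₁) (hc2 : T.op c x₂)
    (hd0 : T.op d x₀) (hd2 : T.op d x₂) :
    ∃ ys : List T.Cm, ys ≠ [] ∧ ys.head? = some x₂ ∧ ys.getLast? = some x₀ ∧
      (∀ y ∈ ys, T.op d y) ∧ ys.Chain' (Adj T.adjm) ∧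
      ∃ G : List (OppC T),
        G.map Subtype.val =
          [(c, x₀), (c, x₁), (c, x₂)] ++ ys.map (fun y => (d, y)) ++ [(c, x₀)] ∧
        IsGallery (oppAdj T) G ∧ NullHomotopic (oppAdj T) G := by
  obtain ⟨j, hj⟩ := h01
  obtain ⟨k, hk⟩ := h12
  have hdc := (T.eqvp i).symm hcd
  have rp (l : I) (a : T.Cp) : T.adjp l a a := (T.eqvp l).refl a
  have rm (l : I) (a : T.Cm) : T.adjm l a a := (T.eqvm l).refl a
  have hj' := (T.eqvm j).symm hj
  have hk' := (T.eqvm k).symm hk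
  let c₀ : OppC T := ⟨(c, x₀), hc0⟩
  let c₁ : OppC T := ⟨(c, x₁), hc1⟩
  let c₂ : OppC T := ⟨(c, x₂), hc2⟩
  let d₀ : OppC T := ⟨(d, x₀), hd0⟩
  let d₂ : OppC T := ⟨(d, x₂), hd2⟩
  have c01 : oppAdj T j c₀ c₁ := ⟨rp j c, hj⟩
  have c12 : oppAdj T k c₁ c₂ := ⟨rp k c, hk⟩
  have cd2 : oppAdj T i c₂ d₂ := ⟨hcd, rm i x₂⟩
  have dc0 : oppAdj T i d₀ c₀ := ⟨hdc, rm i x₀⟩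
  by_cases hd1 : T.op d x₁
  · let d₁ : OppC T := ⟨(d, x₁), hd1⟩
    have d21 : oppAdj T k d₂ d₁ := ⟨rp k d, hk'⟩
    have d10 : oppAdj T j d₁ d₀ := ⟨rp j d, hj'⟩
    have cd1 : oppAdj T i c₁ d₁ := ⟨hcd, rm i x₁⟩
    refine ⟨[x₂, x₁, x₀], by simp, by simp, by simp, by simp [hd0, hd1, hd2],
      .cons_cons ⟨k, hk'⟩ (.cons_cons ⟨j, hj'⟩ (.singleton _)),
      [c₀, c₁, c₂, d₂, d₁, d₀, c₀], rfl, ⟨by simp, ?_⟩, ?_⟩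
    · exact .cons_cons ⟨j, c01⟩ <| .cons_cons ⟨k, c12⟩ <| .cons_cons ⟨i, cd2⟩ <|
        .cons_cons ⟨k, d21⟩ <| .cons_cons ⟨j, d10⟩ <| .cons_cons ⟨i, dc0⟩ <| .singleton _
    · have hshort : NullHomotopic (oppAdj T) [c₀, c₁, d₁, d₀, c₀] :=
        nullHomotopic_of_isChain_pair (a := c₀) i j (by simp) (by simp) (by simp) <|
          .cons_cons ⟨j, by simp, c01⟩ <| .cons_cons ⟨i, by simp, cd1⟩ <|
          .cons_cons ⟨j, by simp, d10⟩ <| .cons_cons ⟨i, by simp, dc0⟩ <| .singleton _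
      obtain ⟨a, ha, hnull⟩ := hshort
      refine ⟨a, ha, .head ⟨[c₀], [c₁, c₂, d₂, d₁], [c₁, d₁], [d₀, c₀], {i, k},
        Set.toFinite _, ncard_pair_le_two i k, by simp, by simp, by simp, by simp, ?_, ?_,
        rfl, rfl⟩ hnull⟩
      · exact .cons_cons ⟨k, by simp, c12⟩ <| .cons_cons ⟨i, by simp, cd2⟩ <|
          .cons_cons ⟨k, by simp, d21⟩ <| .singleton _
      · exact .cons_cons ⟨i, by simp, cd1⟩ <| .singleton _
  · -- By (TCS1) both adjacencies have type `i`, so everything lies in one panel.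
    obtain rfl : j = i := (T.tcs1p i j c d x₀ x₁ hcd hj hd0 hc0 hc1).resolve_left hd1
    obtain rfl : k = j := (T.tcs1p j k c d x₂ x₁ hcd hk' hd2 hc2 hc1).resolve_left hd1
    have h20 := (T.eqvm k).trans hk' hj'
    have d20 : oppAdj T k d₂ d₀ := ⟨rp k d, h20⟩
    refine ⟨[x₂, x₀], by simp, by simp, by simp, by simp [hd0, hd2],
      .cons_cons ⟨k, h20⟩ (.singleton _), [c₀, c₁, c₂, d₂, d₀, c₀], rfl, ⟨by simp, ?_⟩, ?_⟩
    · exact .cons_cons ⟨k, c01⟩ <| .cons_cons ⟨k, c12⟩ <| .cons_cons ⟨k, cd2⟩ <|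
        .cons_cons ⟨k, d20⟩ <| .cons_cons ⟨k, dc0⟩ <| .singleton _
    · exact nullHomotopic_of_isChain_pair (a := c₀) k k (by simp) (by simp) (by simp) <|
        .cons_cons ⟨k, by simp, c01⟩ <| .cons_cons ⟨k, by simp, c12⟩ <|
        .cons_cons ⟨k, by simp, cd2⟩ <| .cons_cons ⟨k, by simp, d20⟩ <|
        .cons_cons ⟨k, by simp, dc0⟩ <| .singleton _

end TwinChamber
end
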